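/- Let T be a tree on t vertices, let s ≤ t - 2, and set n = t + s - 2. If π = (d_1, …, d_n) is a nonincreasing graphic sequence such that π is not potentially T-graphic and the complementary sequence π̄ is not potentially K_s-graphic, then d_{t-s-1} ≥ t and d_t ≥ t - s + 1. -/

import Mathlib

open SimpleGraph
open scoped Classical

/-- Degree of a vertex. -/
noncomputable def deg {V : Type} (G : SimpleGraph V) (v : V) : ℕ := Nat.card (G.neighborSet v)

/-- Number of vertices of degree exactly 1 (leaves for trees/forests). -/
noncomputable def numLeaves {V : Type} (G : SimpleGraph V) : ℕ := Nat.card {v : V // deg G v = 1}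

/-- Number of connected components containing at least one edge. -/
noncomputable def numEdgeComps {V : Type} (G : SimpleGraph V) : ℕ :=
  Nat.card {c : G.ConnectedComponent // ∃ v w : V, G.Adj v w ∧ G.connectedComponentMk v = c}

/-- Maximum degree. -/
noncomputable def maxDeg {V : Type} (G : SimpleGraph V) : ℕ := sSup (Set.range (deg G))

/-- `G` and `H` pack: a bijection sends edges of `H` to non-edges of `G`. -/
def Packs {V W : Type} (G : SimpleGraph V) (H : SimpleGraph W) : Prop :=
  ∃ f : W ≃ V, ∀ x y : W, H.Adj x y → ¬ G.Adj (f x) (f y)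

/-- `G` contains a copy of `H` as a subgraph. -/
def ContainsCopy {V W : Type} (G : SimpleGraph V) (H : SimpleGraph W) : Prop :=
  ∃ f : W ↪ V, ∀ x y : W, H.Adj x y → G.Adj (f x) (f y)

/-- `G` realizes the degree sequence `π`. -/
def IsRealization {n : ℕ} (G : SimpleGraph (Fin n)) (π : Fin n → ℕ) : Prop :=
  ∀ i, deg G i = π i

/-- `π` is a graphic sequence. -/
def Graphic {n : ℕ} (π : Fin n → ℕ) : Prop :=
  ∃ G : SimpleGraph (Fin n), IsRealization G π

/-- `π` is potentially `H`-graphic. -/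
def PotentiallyGraphic {n : ℕ} {W : Type} (π : Fin n → ℕ) (H : SimpleGraph W) : Prop :=
  ∃ G : SimpleGraph (Fin n), IsRealization G π ∧ ContainsCopy G H

/-- The complementary sequence `π̄ = (n-1-d_n, …, n-1-d_1)`. -/
def compSeq {n : ℕ} (π : Fin n → ℕ) : Fin n → ℕ := fun i => n - 1 - π i.rev

/-- The potential-Ramsey number. -/
noncomputable def rpot {W₁ W₂ : Type} (H₁ : SimpleGraph W₁) (H₂ : SimpleGraph W₂) : ℕ :=
  sInf {N : ℕ | ∀ π : Fin N → ℕ, Antitone π → Graphic π →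
    PotentiallyGraphic π H₁ ∨ PotentiallyGraphic (compSeq π) H₂}

/-- The star `K_{1,t-1}` on `t` vertices, centered at vertex `0`. -/
def starGraph (t : ℕ) : SimpleGraph (Fin t) := SimpleGraph.fromRel (fun i _ => (i : ℕ) = 0)

section DegreeToolkit

variable {V : Type}

/-- The graph `G` together with the edge `xy`. -/
def addEdge (G : SimpleGraph V) (x y : V) : SimpleGraph V := G ⊔ edge x y

/-- The graph `G` without the edge `xy`. -/
def delEdge (G : SimpleGraph V) (x y : V) : SimpleGraph V := G.deleteEdges {s(x, y)}

lemma addEdge_adj {G : SimpleGraph V} {x y p q : V} (hxy : x ≠ y) :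
    (addEdge G x y).Adj p q ↔ G.Adj p q ∨ s(p, q) = s(x, y) := by
  simp only [addEdge, sup_adj, edge_adj, Sym2.eq_iff]
  constructor
  · rintro (h | ⟨h, -⟩)
    · exact Or.inl h
    · rcases h with ⟨rfl, rfl⟩ | ⟨rfl, rfl⟩ <;> simp
  · rintro (h | ⟨rfl, rfl⟩ | ⟨rfl, rfl⟩)
    · exact Or.inl h
    · exact Or.inr ⟨by simp, hxy⟩
    · exact Or.inr ⟨by simp, hxy.symm⟩

lemma delEdge_adj {G : SimpleGraph V} {x y p q : V} :
    (delEdge G x y).Adj p q ↔ G.Adj p q ∧ s(p, q) ≠ s(x, y) := by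
  simp [delEdge, deleteEdges_adj]

variable [Fintype V]

/-- The finite set of neighbours of `v`. -/
noncomputable def nbrs (G : SimpleGraph V) (v : V) : Finset V := Finset.univ.filter (G.Adj v)

@[simp] lemma mem_nbrs {G : SimpleGraph V} {v w : V} : w ∈ nbrs G v ↔ G.Adj v w := by
  simp [nbrs]

lemma deg_eq_card_nbrs (G : SimpleGraph V) (v : V) : deg G v = (nbrs G v).card := by
  rw [deg, Nat.card_eq_card_toFinset]
  congr 1
  ext w
  simp

lemma deg_eq_degree (G : SimpleGraph V) (v : V) : deg G v = G.degree v := by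
  rw [deg, Nat.card_eq_fintype_card, card_neighborSet_eq_degree]

lemma even_sum_deg (G : SimpleGraph V) : Even (∑ v, deg G v) := by
  simp only [deg_eq_degree]
  rw [G.sum_degrees_eq_twice_card_edges]
  exact even_two_mul _

lemma deg_congr {G H : SimpleGraph V} {v : V} (h : ∀ w, G.Adj v w ↔ H.Adj v w) :
    deg G v = deg H v := by
  rw [deg_eq_card_nbrs, deg_eq_card_nbrs]
  congr 1
  ext w
  simp [h]

lemma deg_addEdge {G : SimpleGraph V} {x y : V} (hxy : x ≠ y) (hn : ¬ G.Adj x y) (v : V) :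
    deg (addEdge G x y) v = deg G v + (if v = x then 1 else 0) + (if v = y then 1 else 0) := by
  have hn' : ¬ G.Adj y x := fun h => hn h.symm
  by_cases hx : v = x
  · subst hx
    have : nbrs (addEdge G v y) v = insert y (nbrs G v) := by
      ext w
      simp only [mem_nbrs, addEdge_adj hxy, Finset.mem_insert, Sym2.eq_iff]
      grind
    rw [deg_eq_card_nbrs, this, Finset.card_insert_of_notMem (by simpa using hn),
      deg_eq_card_nbrs]
    simp [hxy]
  · by_cases hy : v = y
    · subst hy
      have : nbrs (addEdge G x v) v = insert x (nbrs G v) := by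
        ext w
        simp only [mem_nbrs, addEdge_adj hxy, Finset.mem_insert, Sym2.eq_iff]
        grind
      rw [deg_eq_card_nbrs, this, Finset.card_insert_of_notMem (by simpa using hn'),
        deg_eq_card_nbrs]
      simp [hx]
    · simp only [hx, hy, if_false, add_zero]
      refine deg_congr fun w => ?_
      simp only [addEdge_adj hxy, Sym2.eq_iff]
      grind

lemma deg_delEdge {G : SimpleGraph V} {x y : V} (h : G.Adj x y) (v : V) :
    deg G v = deg (delEdge G x y) v + (if v = x then 1 else 0) + (if v = y then 1 else 0) := by
  rw [← deg_addEdge h.ne (by simp [delEdge_adj])]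
  refine deg_congr fun w => ?_
  rw [addEdge_adj h.ne, delEdge_adj]
  by_cases e : s(v, w) = s(x, y)
  · simp only [e, or_true, iff_true]
    rcases Sym2.eq_iff.1 e with ⟨rfl, rfl⟩ | ⟨rfl, rfl⟩
    · exact h
    · exact h.symm
  · simp [e]

/-- The neighbours of `w` that `x` could gain. -/
noncomputable def exch (G : SimpleGraph V) (w x : V) : Finset V := (nbrs G w \ nbrs G x).erase x

lemma mem_exch {G : SimpleGraph V} {w x z : V} :
    z ∈ exch G w x ↔ z ≠ x ∧ G.Adj w z ∧ ¬ G.Adj x z := by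
  simp [exch]

lemma card_exch_add (G : SimpleGraph V) (w x : V) :
    (exch G w x).card + deg G x = deg G w + (exch G x w).card := by
  have h1 := Finset.card_sdiff_add_card_inter (nbrs G w) (nbrs G x)
  have h2 := Finset.card_sdiff_add_card_inter (nbrs G x) (nbrs G w)
  rw [Finset.inter_comm] at h2
  by_cases h : G.Adj w x
  · have m1 : x ∈ nbrs G w \ nbrs G x := by simp [h]
    have m2 : w ∈ nbrs G x \ nbrs G w := by simp [h.symm]
    have c1 := Finset.card_erase_add_one m1
    have c2 := Finset.card_erase_add_one m2
    simp only [exch, deg_eq_card_nbrs]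
    omega
  · have m1 : x ∉ nbrs G w \ nbrs G x := by simp [h]
    have m2 : w ∉ nbrs G x \ nbrs G w := by simp [G.adj_comm x w, h]
    simp only [exch, deg_eq_card_nbrs, Finset.erase_eq_of_notMem m1, Finset.erase_eq_of_notMem m2]
    omega

lemma exch_nonempty_of_lt {G : SimpleGraph V} {w x : V} (h : deg G x < deg G w) :
    ∃ z, z ≠ x ∧ G.Adj w z ∧ ¬ G.Adj x z := by
  have := card_exch_add G w x
  obtain ⟨z, hz⟩ := Finset.card_pos.1 (show 0 < (exch G w x).card by omega)
  exact ⟨z, mem_exch.1 hz⟩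

lemma exch_nonempty_of_le {G : SimpleGraph V} {w x p : V} (h : deg G x ≤ deg G w)
    (hpw : p ≠ w) (hp : G.Adj x p) (hp' : ¬ G.Adj w p) :
    ∃ z, z ≠ x ∧ G.Adj w z ∧ ¬ G.Adj x z := by
  have := card_exch_add G w x
  have : 0 < (exch G x w).card := Finset.card_pos.2 ⟨p, mem_exch.2 ⟨hpw, hp, hp'⟩⟩
  obtain ⟨z, hz⟩ := Finset.card_pos.1 (show 0 < (exch G w x).card by omega)
  exact ⟨z, mem_exch.1 hz⟩

lemma exch_nonempty_ne {G : SimpleGraph V} {w x : V} (h : deg G x + 2 ≤ deg G w) (j : V) :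
    ∃ z, z ≠ j ∧ z ≠ x ∧ G.Adj w z ∧ ¬ G.Adj x z := by
  have := card_exch_add G w x
  obtain ⟨z, hz, hj⟩ := Finset.exists_mem_ne (show 1 < (exch G w x).card by omega) j
  exact ⟨z, hj, mem_exch.1 hz⟩

/-- The graph obtained by exchanging the edges `ab`, `ce` for `ac`, `be`. -/
lemma exists_edge_exchange {G : SimpleGraph V} {a b c e : V} (hab : G.Adj a b) (hce : G.Adj c e)
    (hac : ¬ G.Adj a c) (hbe : ¬ G.Adj b e) (nac : a ≠ c) (nbe : b ≠ e) :
    ∃ G' : SimpleGraph V, (∀ v, deg G' v = deg G v) ∧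
      ∀ p q, G'.Adj p q ↔ (G.Adj p q ∧ s(p, q) ≠ s(a, b) ∧ s(p, q) ≠ s(c, e)) ∨
        s(p, q) = s(a, c) ∨ s(p, q) = s(b, e) := by
  have hne : s(c, e) ≠ s(a, b) := by
    intro h
    rcases Sym2.eq_iff.1 h with ⟨rfl, rfl⟩ | ⟨rfl, rfl⟩
    · exact nac rfl
    · exact hac hab
  have h2 : (delEdge G a b).Adj c e := delEdge_adj.2 ⟨hce, hne⟩
  have h3 : ¬ (delEdge (delEdge G a b) c e).Adj a c := by simp [delEdge_adj, hac]
  have h4 : ¬ (addEdge (delEdge (delEdge G a b) c e) a c).Adj b e := by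
    rw [addEdge_adj nac, delEdge_adj, delEdge_adj]
    simp only [hbe, false_and, false_or, Sym2.eq_iff, not_or, not_and]
    have := hab.ne
    have := hce.ne
    grind
  refine ⟨addEdge (addEdge (delEdge (delEdge G a b) c e) a c) b e, fun v => ?_, fun p q => ?_⟩
  · rw [deg_addEdge nbe h4, deg_addEdge nac h3, deg_delEdge hab, deg_delEdge h2]
    omega
  · rw [addEdge_adj nbe, addEdge_adj nac, delEdge_adj, delEdge_adj]
    tauto

end DegreeToolkit

section TreeEmbedding

lemma exists_leaf {W : Type} [Fintype W] {T : SimpleGraph W} (hT : T.IsTree)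
    (hW : 2 ≤ Fintype.card W) :
    ∃ y x, T.Adj x y ∧ (∀ z, T.Adj z y → z = x) ∧ (T.induce {y}ᶜ).IsTree := by
  have : Nontrivial W := Fintype.one_lt_card_iff_nontrivial.1 hW
  obtain ⟨y, hy⟩ := hT.exists_vert_degree_one_of_nontrivial
  obtain ⟨x, hx, hu⟩ := degree_eq_one_iff_existsUnique_adj.1 hy
  exact ⟨y, x, hx.symm, fun z hz => hu z hz.symm,
    hT.connected.induce_compl_singleton_of_degree_eq_one hy, hT.isAcyclic.induce _⟩

/-- An embedding of a tree without a leaf extends to the leaf. -/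
lemma exists_extend_leaf {V W : Type} {G : SimpleGraph V} {T : SimpleGraph W} {x y : W}
    (hxy : T.Adj x y) (hu : ∀ z, T.Adj z y → z = x) (f : ↥({y}ᶜ : Set W) ↪ V)
    (hf : ∀ a b, (T.induce {y}ᶜ).Adj a b → G.Adj (f a) (f b)) {v : V} (hv : ∀ a, f a ≠ v)
    (hadj : G.Adj (f ⟨x, hxy.ne⟩) v) :
    ∃ g : W ↪ V, (∀ a, g a = v ∨ ∃ b, g a = f b) ∧ ∀ a b, T.Adj a b → G.Adj (g a) (g b) := by
  refine ⟨⟨fun w => if h : w = y then v else f ⟨w, h⟩, fun a b hab => ?_⟩, fun a => ?_,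
    fun a b hab => ?_⟩
  · by_cases ha : a = y <;> by_cases hb : b = y
    · rw [ha, hb]
    · simp only [ha, hb, dite_true, dite_false] at hab
      exact absurd hab.symm (hv _)
    · simp only [ha, hb, dite_true, dite_false] at hab
      exact absurd hab (hv _)
    · simp only [ha, hb, dite_false] at hab
      exact congrArg Subtype.val (f.injective hab)
  · by_cases ha : a = y
    · exact Or.inl (dif_pos ha)
    · exact Or.inr ⟨⟨a, ha⟩, dif_neg ha⟩
  · change G.Adj (if h : a = y then v else f ⟨a, h⟩) (if h : b = y then v else f ⟨b, h⟩)
    by_cases ha : a = y <;> by_cases hb : b = y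
    · exact absurd (ha.trans hb.symm) hab.ne
    · subst ha
      obtain rfl := hu b hab.symm
      simpa [hb] using hadj.symm
    · subst hb
      obtain rfl := hu a hab
      simpa [ha] using hadj
    · simpa [ha, hb] using hf ⟨a, ha⟩ ⟨b, hb⟩ hab

variable {V : Type} [Fintype V]

lemma card_compl_singleton_add_one {W : Type} [Fintype W] (y : W) :
    Fintype.card ↥({y}ᶜ : Set W) + 1 = Fintype.card W := by
  have := Fintype.card_compl_set ({y} : Set W)
  have h : 0 < Fintype.card W := Fintype.card_pos_iff.2 ⟨y⟩
  simp only [Set.card_singleton] at this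
  omega

/-- A tree embeds into any large enough set of vertices of largest degree, after a change of the
realization. -/
lemma exists_tree_embedding {G : SimpleGraph V} {A : Finset V}
    (hA : ∀ v ∈ A, ∀ p, p ∉ A → deg G p ≤ deg G v) (k : ℕ) {W : Type} [Fintype W]
    {T : SimpleGraph W} (hT : T.IsTree) (hW : Fintype.card W = k) (hk : k ≤ A.card)
    (hdeg : ∀ a ∈ A, k ≤ deg G a + 1) :
    ∃ G' : SimpleGraph V, (∀ v, deg G' v = deg G v) ∧
      ∃ f : W ↪ V, (∀ x, f x ∈ A) ∧ ∀ x y, T.Adj x y → G'.Adj (f x) (f y) := by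
  induction k generalizing W with
  | zero =>
    have := hT.connected.nonempty
    exact absurd hW Fintype.card_pos.ne'
  | succ k ih =>
    rcases Nat.eq_zero_or_pos k with rfl | hk0
    · have : Subsingleton W := Fintype.card_le_one_iff_subsingleton.1 (by omega)
      obtain ⟨a, ha⟩ := Finset.card_pos.1 (show 0 < A.card by omega)
      exact ⟨G, fun _ => rfl, ⟨fun _ => a, fun x y _ => Subsingleton.elim x y⟩, fun _ => ha,
        fun x y h => absurd (Subsingleton.elim x y) h.ne⟩
    obtain ⟨y, x, hxy, hu, hT'⟩ := exists_leaf hT (by omega)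
    have hc := card_compl_singleton_add_one y
    obtain ⟨G₁, hG₁, f, hfA, hf⟩ := ih hT' (by omega) (by omega)
      (fun a ha => by have := hdeg a ha; omega)
    set R : Finset V := Finset.univ.map f with hR
    have hRc : R.card = k := by rw [hR, Finset.card_map, Finset.card_univ]; omega
    have hmemR : ∀ v, v ∈ R ↔ ∃ a, f a = v := by simp [hR]
    set u := f ⟨x, hxy.ne⟩ with hu'
    have huA : u ∈ A := hfA _
    have huR : u ∈ R := (hmemR u).2 ⟨_, rfl⟩
    have conclude : ∀ (G₂ : SimpleGraph V) (v : V), (∀ w, deg G₂ w = deg G₁ w) → v ∈ A → v ∉ R →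
        (∀ a b, G₁.Adj (f a) (f b) → G₂.Adj (f a) (f b)) → G₂.Adj u v →
        ∃ G' : SimpleGraph V, (∀ v, deg G' v = deg G v) ∧
          ∃ f : W ↪ V, (∀ x, f x ∈ A) ∧ ∀ x y, T.Adj x y → G'.Adj (f x) (f y) := by
      intro G₂ v hdeg₂ hvA hvR hG₂ huv
      obtain ⟨g, hg, hgadj⟩ := exists_extend_leaf hxy hu f
        (fun a b hab => hG₂ a b (hf a b hab)) (fun a ha => hvR ((hmemR v).2 ⟨a, ha⟩)) huv
      refine ⟨G₂, fun w => (hdeg₂ w).trans (hG₁ w), g, fun a => ?_, hgadj⟩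
      rcases hg a with h | ⟨b, h⟩
      · rw [h]; exact hvA
      · rw [h]; exact hfA b
    obtain ⟨v, hvA, hvR⟩ := Finset.exists_mem_notMem_of_card_lt_card (show R.card < A.card by omega)
    by_cases hE : ∃ v ∈ A, v ∉ R ∧ G₁.Adj u v
    · obtain ⟨v, hvA, hvR, huv⟩ := hE
      exact conclude G₁ v (fun _ => rfl) hvA hvR (fun _ _ h => h) huv
    · push Not at hE
      have huv := hE v hvA hvR
      obtain ⟨p, hp, hpR⟩ := Finset.exists_mem_notMem_of_card_lt_card
        (show (R.erase u).card < (nbrs G₁ u).card by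
          rw [Finset.card_erase_of_mem huR, hRc, ← deg_eq_card_nbrs, hG₁]
          have := hdeg u huA
          omega)
      have hup : G₁.Adj u p := mem_nbrs.1 hp
      have hpR : p ∉ R := fun h => hpR (Finset.mem_erase.2 ⟨hup.ne', h⟩)
      have hpA : p ∉ A := fun h => hE p h hpR hup
      have hle : deg G₁ p ≤ deg G₁ v := by rw [hG₁, hG₁]; exact hA v hvA p hpA
      have hnuv : u ≠ v := fun h => hvR (h ▸ huR)
      obtain ⟨q, hqp, hvq, hpq⟩ := exch_nonempty_of_le hle hnuv hup.symm (fun h => huv h.symm)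
      obtain ⟨G₂, hG₂, hadj⟩ := exists_edge_exchange hup hvq huv hpq hnuv hqp.symm
      refine conclude G₂ v hG₂ hvA hvR (fun a b hab => ?_) ((hadj _ _).2 (by simp))
      refine (hadj _ _).2 (Or.inl ⟨hab, ?_, ?_⟩)
      · intro h
        have : p ∈ s(f a, f b) := h ▸ Sym2.mem_mk_right u p
        rcases Sym2.mem_iff.1 this with h | h <;> exact hpR ((hmemR p).2 ⟨_, h.symm⟩)
      · intro h
        have : v ∈ s(f a, f b) := h ▸ Sym2.mem_mk_left v q
        rcases Sym2.mem_iff.1 this with h | h <;> exact hvR ((hmemR v).2 ⟨_, h.symm⟩)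

/-- A tree on `t` vertices is contained in some graph with the given degrees as soon as `t - 1`
vertices of largest degree have degree at least `t - 1`. -/
lemma exists_containsCopy_tree {G : SimpleGraph V} {A : Finset V} {W : Type} [Fintype W]
    {T : SimpleGraph W} (hT : T.IsTree) (hA : ∀ v ∈ A, ∀ p, p ∉ A → deg G p ≤ deg G v)
    (hW : Fintype.card W = A.card + 1) (hA1 : 1 ≤ A.card) (hdeg : ∀ a ∈ A, A.card ≤ deg G a) :
    ∃ G' : SimpleGraph V, (∀ v, deg G' v = deg G v) ∧ ContainsCopy G' T := by
  obtain ⟨y, x, hxy, hu, hT'⟩ := exists_leaf hT (by omega)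
  have hc := card_compl_singleton_add_one y
  obtain ⟨G₁, hG₁, f, hfA, hf⟩ := exists_tree_embedding hA A.card hT' (by omega) le_rfl
    (fun a ha => (hdeg a ha).trans (Nat.le_succ _))
  set u := f ⟨x, hxy.ne⟩ with hu'
  have huA : u ∈ A := hfA _
  obtain ⟨p, hp, hpA⟩ := Finset.exists_mem_notMem_of_card_lt_card
    (show (A.erase u).card < (nbrs G₁ u).card by
      rw [Finset.card_erase_of_mem huA, ← deg_eq_card_nbrs, hG₁]
      have := hdeg u huA
      omega)
  have hup : G₁.Adj u p := mem_nbrs.1 hp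
  obtain ⟨g, -, hg⟩ := exists_extend_leaf hxy hu f hf
    (v := p) (fun a ha => hpA (Finset.mem_erase.2 ⟨hup.ne', (show f a = p from ha) ▸ hfA a⟩)) hup
  exact ⟨G₁, hG₁, g, hg⟩

/-- A vertex can be made adjacent to any set of vertices of largest degree, as long as its degree
allows it. -/
lemma exists_adj_all {G : SimpleGraph V} {S : Finset V} {v : V} (hv : v ∉ S)
    (hS : S.card ≤ deg G v) (hdeg : ∀ x ∈ S, ∀ y, y ∉ S → y ≠ v → deg G y ≤ deg G x) :
    ∃ G' : SimpleGraph V, (∀ w, deg G' w = deg G w) ∧ ∀ x ∈ S, G'.Adj v x := by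
  obtain ⟨G', hG', hmax⟩ := (Set.toFinite {G' : SimpleGraph V | ∀ w, deg G' w = deg G w}).exists_maximalFor
    (fun G' => (nbrs G' v ∩ S).card) _ ⟨G, fun _ => rfl⟩
  refine ⟨G', hG', fun x hx => ?_⟩
  by_contra hvx
  obtain ⟨p, hp, hpS⟩ := Finset.exists_mem_notMem_of_card_lt_card
    (show (nbrs G' v ∩ S).card < (nbrs G' v).card by
      rw [← deg_eq_card_nbrs, hG']
      refine lt_of_lt_of_le (Finset.card_lt_card (Finset.ssubset_iff_of_subset
        Finset.inter_subset_right |>.2 ⟨x, hx, ?_⟩)) hS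
      simp [hvx])
  have hvp : G'.Adj v p := mem_nbrs.1 hp
  have hpS : p ∉ S := fun h => hpS (Finset.mem_inter.2 ⟨hp, h⟩)
  have hle : deg G' p ≤ deg G' x := by rw [hG', hG']; exact hdeg x hx p hpS hvp.ne'
  have hnvx : v ≠ x := fun h => hv (h ▸ hx)
  obtain ⟨z, hzp, hxz, hpz⟩ := exch_nonempty_of_le hle hnvx hvp.symm (fun h => hvx h.symm)
  obtain ⟨G₂, hG₂, hadj⟩ := exists_edge_exchange hvp hxz hvx hpz hnvx hzp.symm
  have hlt : (nbrs G' v ∩ S).card < (nbrs G₂ v ∩ S).card := by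
    refine Finset.card_lt_card ((Finset.ssubset_iff_of_subset fun w hw => ?_).2
      ⟨x, by simp [hx, hadj], by simp [hvx]⟩)
    simp only [Finset.mem_inter, mem_nbrs] at hw ⊢
    refine ⟨(hadj _ _).2 (Or.inl ⟨hw.1, fun h => ?_, fun h => ?_⟩), hw.2⟩
    · rcases Sym2.eq_iff.1 h with ⟨-, h⟩ | ⟨h, -⟩
      · exact hpS (h ▸ hw.2)
      · exact hvp.ne h
    · rcases Sym2.eq_iff.1 h with ⟨h, -⟩ | ⟨-, h⟩
      · exact hnvx h
      · exact hvx (h ▸ hw.1)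
  exact hlt.not_ge (hmax (fun w => (hG₂ w).trans (hG' w)) hlt.le)

end TreeEmbedding

section SubRealization

variable {V : Type}

/-- `H` realizes `d` on the clique `A` and does not exceed `d` elsewhere. -/
def IsSubRealization (A : Finset V) (d : V → ℕ) (H : SimpleGraph V) : Prop :=
  (∀ a ∈ A, ∀ b ∈ A, a ≠ b → H.Adj a b) ∧ (∀ a ∈ A, deg H a = d a) ∧ ∀ v, deg H v ≤ d v

/-- Both `x` and `y` miss an edge in `H`; if `x = y`, they miss two edges. -/
def Deficient (d : V → ℕ) (H : SimpleGraph V) (x y : V) : Prop :=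
  deg H x < d x ∧ deg H y < d y ∧ (x = y → deg H x + 2 ≤ d x)

lemma Deficient.symm {d : V → ℕ} {H : SimpleGraph V} {x y : V} (h : Deficient d H x y) :
    Deficient d H y x :=
  ⟨h.2.1, h.1, fun e => e ▸ h.2.2 e.symm⟩

lemma deficient_of_ne {d : V → ℕ} {H : SimpleGraph V} {x y : V} (hx : deg H x < d x)
    (hy : deg H y < d y) (hxy : x ≠ y) : Deficient d H x y :=
  ⟨hx, hy, fun e => absurd e hxy⟩

variable {A : Finset V} {d : V → ℕ} {H : SimpleGraph V}

lemma IsSubRealization.notMem (hH : IsSubRealization A d H) {x : V} (hx : deg H x < d x) :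
    x ∉ A :=
  fun h => hx.ne (hH.2.1 x h)

variable [Fintype V]

/-- A subrealization with as many edges as possible. -/
def IsMaxSubRealization (A : Finset V) (d : V → ℕ) (H : SimpleGraph V) : Prop :=
  IsSubRealization A d H ∧
    ∀ H', IsSubRealization A d H' → ∑ v, deg H' v ≤ ∑ v, deg H v

lemma exists_deficient (h : ∀ v, deg H v ≤ d v) (hd : Even (∑ v, d v)) {x : V}
    (hx : deg H x < d x) : ∃ y, Deficient d H x y := by
  by_cases hy : ∃ y, y ≠ x ∧ deg H y < d y
  · obtain ⟨y, hyx, hy⟩ := hy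
    exact ⟨y, deficient_of_ne hx hy hyx.symm⟩
  · push Not at hy
    have h1 : ∑ v ∈ Finset.univ.erase x, deg H v = ∑ v ∈ Finset.univ.erase x, d v :=
      Finset.sum_congr rfl fun v hv => le_antisymm (h v) (hy v (Finset.ne_of_mem_erase hv))
    have h2 := Finset.add_sum_erase Finset.univ (deg H) (Finset.mem_univ x)
    have h3 := Finset.add_sum_erase Finset.univ d (Finset.mem_univ x)
    obtain ⟨a, ha⟩ := even_sum_deg H
    obtain ⟨b, hb⟩ := hd
    exact ⟨x, hx, hx, fun _ => by omega⟩

namespace IsMaxSubRealization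

lemma adj_of_deficient (hH : IsMaxSubRealization A d H) {x y : V} (hx : deg H x < d x)
    (hy : deg H y < d y) (hxy : x ≠ y) : H.Adj x y := by
  by_contra hn
  have hdeg := deg_addEdge hxy hn
  have hsub : IsSubRealization A d (addEdge H x y) := by
    refine ⟨fun a ha b hb hab => (addEdge_adj hxy).2 (Or.inl (hH.1.1 a ha b hb hab)),
      fun a ha => ?_, fun v => ?_⟩
    · rw [hdeg, if_neg fun e : a = x => hH.1.notMem hx (e ▸ ha),
        if_neg fun e : a = y => hH.1.notMem hy (e ▸ ha), hH.1.2.1 a ha, add_zero, add_zero]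
    · have := hH.1.2.2 v
      rw [hdeg]
      split_ifs with h1 h2 h2
      · exact absurd (h1.symm.trans h2) hxy
      · subst h1; omega
      · subst h2; omega
      · omega
  have := hH.2 _ hsub
  simp only [hdeg, Finset.sum_add_distrib, Finset.sum_ite_eq', Finset.mem_univ, if_true] at this
  omega

lemma augment_false (hH : IsMaxSubRealization A d H) {x y z w : V} (hp : Deficient d H x y)
    (hzx : z ≠ x) (hxz : ¬ H.Adj x z) (hwy : w ≠ y) (hyw : ¬ H.Adj y w) (hzw : H.Adj z w)
    (hA : z ∉ A ∨ w ∉ A) : False := by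
  have n1 : ¬ (delEdge H z w).Adj x z := by simp [delEdge_adj, hxz]
  have n2 : ¬ (addEdge (delEdge H z w) x z).Adj y w := by
    rw [addEdge_adj hzx.symm, delEdge_adj]
    simp only [hyw, false_and, false_or, Sym2.eq_iff]
    rintro (⟨rfl, rfl⟩ | ⟨rfl, rfl⟩)
    · exact hzw.ne rfl
    · exact hyw hzw
  have hdeg : ∀ v, deg (addEdge (addEdge (delEdge H z w) x z) y w) v =
      deg H v + (if v = x then 1 else 0) + (if v = y then 1 else 0) := fun v => by
    rw [deg_addEdge hwy.symm n2, deg_addEdge hzx.symm n1, deg_delEdge hzw]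
    omega
  have hxA := hH.1.notMem hp.1
  have hyA := hH.1.notMem hp.2.1
  have hsub : IsSubRealization A d (addEdge (addEdge (delEdge H z w) x z) y w) := by
    refine ⟨fun a ha b hb hab => ?_, fun a ha => ?_, fun v => ?_⟩
    · rw [addEdge_adj hwy.symm, addEdge_adj hzx.symm, delEdge_adj]
      refine Or.inl (Or.inl ⟨hH.1.1 a ha b hb hab, fun e => ?_⟩)
      rcases Sym2.eq_iff.1 e with ⟨rfl, rfl⟩ | ⟨rfl, rfl⟩ <;> tauto
    · rw [hdeg, if_neg fun e : a = x => hxA (e ▸ ha), if_neg fun e : a = y => hyA (e ▸ ha),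
        hH.1.2.1 a ha, add_zero, add_zero]
    · have := hH.1.2.2 v
      obtain ⟨h1, h2, h3⟩ := hp
      rw [hdeg]
      split_ifs with e1 e2 e2
      · have := h3 (e1.symm.trans e2); subst e1; omega
      · subst e1; omega
      · subst e2; omega
      · omega
  have := hH.2 _ hsub
  simp only [hdeg, Finset.sum_add_distrib, Finset.sum_ite_eq', Finset.mem_univ, if_true] at this
  omega

/-- A deficiency can be moved from `x` to `w`. -/
lemma exists_move (hH : IsMaxSubRealization A d H) {x z w : V} (hx : deg H x < d x) (hzx : z ≠ x)
    (hxz : ¬ H.Adj x z) (hwz : H.Adj w z) (hwA : w ∉ A) (hwx : w ≠ x) :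
    ∃ H', IsMaxSubRealization A d H' ∧ (∀ y, Deficient d H x y → Deficient d H' w y) ∧
      ∀ p q, H'.Adj p q ↔ (H.Adj p q ∧ s(p, q) ≠ s(z, w)) ∨ s(p, q) = s(x, z) := by
  have hzw := hwz.symm
  have n1 : ¬ (delEdge H z w).Adj x z := by simp [delEdge_adj, hxz]
  have hdeg : ∀ v, deg (addEdge (delEdge H z w) x z) v + (if v = w then 1 else 0) =
      deg H v + (if v = x then 1 else 0) := fun v => by
    rw [deg_addEdge hzx.symm n1, deg_delEdge hzw]
    omega
  have hxA := hH.1.notMem hx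
  refine ⟨addEdge (delEdge H z w) x z, ⟨⟨fun a ha b hb hab => ?_, fun a ha => ?_, fun v => ?_⟩,
    fun H' hH' => ?_⟩, fun y hp => ?_, fun p q => ?_⟩
  · rw [addEdge_adj hzx.symm, delEdge_adj]
    refine Or.inl ⟨hH.1.1 a ha b hb hab, fun e => ?_⟩
    rcases Sym2.eq_iff.1 e with ⟨rfl, rfl⟩ | ⟨rfl, rfl⟩ <;> tauto
  · have := hdeg a
    rw [if_neg fun e : a = x => hxA (e ▸ ha), if_neg fun e : a = w => hwA (e ▸ ha)] at this
    rw [← hH.1.2.1 a ha]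
    omega
  · have := hdeg v
    have := hH.1.2.2 v
    by_cases e : v = x
    · subst e; simp only [if_true] at *; omega
    · simp only [e, if_false] at *; omega
  · have h1 : ∑ v, (deg (addEdge (delEdge H z w) x z) v + (if v = w then 1 else 0)) =
        ∑ v, (deg H v + (if v = x then 1 else 0)) := Finset.sum_congr rfl fun v _ => hdeg v
    simp only [Finset.sum_add_distrib, Finset.sum_ite_eq', Finset.mem_univ, if_true] at h1
    have := hH.2 H' hH'
    omega
  · obtain ⟨h1, h2, h3⟩ := hp
    have hw := hdeg w
    have hy := hdeg y
    have hw' := hH.1.2.2 w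
    simp only [if_true, hwx, if_false] at hw
    refine ⟨by omega, ?_, fun e => ?_⟩
    · by_cases e : y = x
      · have := h3 e.symm
        subst e
        simp only [if_true] at hy
        omega
      · simp only [e, if_false] at hy
        omega
    · subst e
      omega
  · rw [addEdge_adj hzx.symm, delEdge_adj]

lemma adj_of_deficient_of_le (hH : IsMaxSubRealization A d H) {x y w : V}
    (hp : Deficient d H x y) (hwA : w ∉ A) (hwy : w ≠ y) (hdw : d x ≤ d w) : H.Adj y w := by
  by_contra hyw
  by_cases hw : deg H w < d w
  · exact hyw (hH.adj_of_deficient hp.2.1 hw hwy.symm)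
  · obtain ⟨z, hzx, hwz, hxz⟩ := exch_nonempty_of_lt (show deg H x < deg H w by
      have := hp.1; omega)
    exact hH.augment_false hp hzx hxz hwy hyw hwz.symm (Or.inr hwA)

variable {D : ℕ} {B : Finset V}

/-- Deficiencies can be moved to vertices of largest demand. -/
lemma exists_deficient_mem (hH : IsMaxSubRealization A d H) (hB : ∀ v, v ∈ B ↔ v ∉ A ∧ d v = D)
    (hD : ∀ v, v ∉ A → d v ≤ D) (hne : B.Nonempty) {x y : V} (hp : Deficient d H x y) :
    ∃ H', IsMaxSubRealization A d H' ∧ ∃ x ∈ B, ∃ y ∈ B, Deficient d H' x y := by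
  obtain ⟨w, hw⟩ := hne
  obtain ⟨hwA, hwD⟩ := (hB w).1 hw
  -- it suffices to start from a pair whose first vertex is `w`
  have key : ∀ (H : SimpleGraph V), IsMaxSubRealization A d H → ∀ y, Deficient d H w y →
      ∃ H', IsMaxSubRealization A d H' ∧ ∃ x ∈ B, ∃ y ∈ B, Deficient d H' x y := by
    intro H hH y hp
    by_cases hyB : y ∈ B
    · exact ⟨H, hH, w, hw, y, hyB, hp⟩
    have hyA := hH.1.notMem hp.2.1
    have hyD : d y < D := lt_of_le_of_ne (hD y hyA) fun e => hyB ((hB y).2 ⟨hyA, e⟩)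
    have hwy : w ≠ y := fun e => hyB (e ▸ hw)
    by_cases h2 : deg H w + 2 ≤ d w
    · exact ⟨H, hH, w, hw, w, hw, hp.1, hp.1, fun _ => h2⟩
    · obtain ⟨z, hzy, hwz, hyz⟩ := exch_nonempty_of_lt (show deg H y < deg H w by
        have := hp.2.1; omega)
      obtain ⟨H', hH', hp', -⟩ := hH.exists_move hp.2.1 hzy hyz hwz hwA hwy
      exact ⟨H', hH', w, hw, w, hw, hp' w hp.symm⟩
  by_cases hwx : w = x
  · subst hwx
    exact key H hH y hp
  by_cases hwd : deg H w < d w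
  · exact key H hH x (deficient_of_ne hwd hp.1 hwx)
  · obtain ⟨z, hzx, hwz, hxz⟩ := exch_nonempty_of_lt (show deg H x < deg H w by
      have := hp.1; have := hD x (hH.1.notMem hp.1); omega)
    obtain ⟨H', hH', hp', -⟩ := hH.exists_move hp.1 hzx hxz hwz hwA hwx
    exact key H' hH' y (hp' y hp)

lemma adj_of_mem (hH : IsMaxSubRealization A d H) (hB : ∀ v, v ∈ B ↔ v ∉ A ∧ d v = D)
    {x y : V} (hx : x ∈ B) (hy : y ∈ B) (hp : Deficient d H x y) {w w' : V} (hw : w ∈ B)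
    (hw' : w' ∈ B) (hne : w ≠ w') : H.Adj w w' := by
  have key : ∀ H : SimpleGraph V, IsMaxSubRealization A d H → ∀ y ∈ B, Deficient d H y w →
      H.Adj w w' := fun H hH y hy hp =>
    hH.adj_of_deficient_of_le hp ((hB w').1 hw').1 hne.symm
      (by rw [((hB y).1 hy).2, ((hB w').1 hw').2])
  by_cases hwx : w = x
  · subst hwx
    exact key H hH y hy hp.symm
  by_cases hwd : deg H w < d w
  · exact key H hH x hx (deficient_of_ne hp.1 hwd (Ne.symm hwx))
  · obtain ⟨z, hzx, hwz, hxz⟩ := exch_nonempty_of_lt (show deg H x < deg H w by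
      have := hp.1; have := ((hB x).1 hx).2; have := ((hB w).1 hw).2; omega)
    obtain ⟨H', hH', hp', hadj⟩ := hH.exists_move hp.1 hzx hxz hwz ((hB w).1 hw).1 hwx
    rcases (hadj _ _).1 (key H' hH' y hy (hp' y hp).symm) with h | h
    · exact h.1
    · rcases Sym2.eq_iff.1 h with ⟨h, -⟩ | ⟨rfl, -⟩
      · exact absurd h hwx
      · exact absurd hwz (H.irrefl)

lemma adj_of_adj_of_deficient (hH : IsMaxSubRealization A d H)
    (hB : ∀ v, v ∈ B ↔ v ∉ A ∧ d v = D) {y w₀ w z j : V} (hp : Deficient d H w₀ y) (hy : y ∈ B)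
    (hw : w ∈ B) (hne : w₀ ≠ w) (hz : z ≠ w₀) (hwz : ¬ H.Adj w₀ z) (hzj : H.Adj z j)
    (hjA : j ∉ A) (hwj : w ≠ j) : H.Adj j w := by
  by_contra hjw
  have hyD := ((hB y).1 hy).2
  obtain ⟨hwA, hwD⟩ := (hB w).1 hw
  by_cases hwd : deg H w < d w
  · exact hH.augment_false (deficient_of_ne hp.1 hwd hne) hz hwz hwj.symm
      (fun h => hjw h.symm) hzj (Or.inr hjA)
  have hyw : w ≠ y := fun e => hwd (e ▸ hp.2.1)
  have hzy : z ≠ y ∨ y = w₀ := by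
    by_contra! h
    exact hwz (h.1 ▸ hH.adj_of_deficient hp.1 hp.2.1 h.2.symm)
  obtain ⟨ζ, hζz, hζy, hwζ, hyζ⟩ : ∃ ζ, (y = w₀ → ζ ≠ z) ∧ ζ ≠ y ∧ H.Adj w ζ ∧ ¬ H.Adj y ζ := by
    by_cases e : y = w₀
    · obtain ⟨ζ, h1, h2⟩ := exch_nonempty_ne (show deg H y + 2 ≤ deg H w by
        have := hp.2.2 e.symm; subst e; omega) z
      exact ⟨ζ, fun _ => h1, h2⟩
    · obtain ⟨ζ, h2⟩ := exch_nonempty_of_lt (show deg H y < deg H w by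
        have := hp.2.1; omega)
      exact ⟨ζ, fun h => absurd h e, h2⟩
  obtain ⟨H', hH', hp', hadj⟩ := hH.exists_move hp.2.1 hζy hyζ hwζ hwA hyw
  have := hwζ.ne
  have hc := H.adj_comm
  refine hH'.augment_false (hp' w₀ hp.symm).symm hz ?_ hwj.symm ?_ ?_ (Or.inr hjA) (z := z)
  all_goals simp only [hadj, Sym2.eq_iff, ne_eq]
  all_goals grind

lemma adj_of_adj_of_ne (hH : IsMaxSubRealization A d H)
    (hB : ∀ v, v ∈ B ↔ v ∉ A ∧ d v = D) {x y w₀ w z j : V} (hx : x ∈ B) (hy : y ∈ B)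
    (hp : Deficient d H x y) (hw₀ : w₀ ∈ B)
    (hw : w ∈ B) (hne : w₀ ≠ w) (hz : z ≠ w₀) (hwz : ¬ H.Adj w₀ z) (hzj : H.Adj z j)
    (hjA : j ∉ A) (hwj : w ≠ j) : H.Adj j w := by
  wlog hxw : x ≠ w ∨ y = w generalizing x y
  · exact this hy hx hp.symm (by tauto)
  by_cases h0 : w₀ = x
  · subst h0
    exact hH.adj_of_adj_of_deficient hB hp hy hw hne hz hwz hzj hjA hwj
  by_cases hd0 : deg H w₀ < d w₀
  · exact hH.adj_of_adj_of_deficient hB (deficient_of_ne hd0 hp.1 h0) hx hw hne hz hwz hzj hjA hwj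
  by_contra hjw
  obtain ⟨hwA, hwD⟩ := (hB w₀).1 hw₀
  have hxD := ((hB x).1 hx).2
  have hxw' : x ≠ w → H.Adj x w := hH.adj_of_mem hB hx hy hp hx hw
  obtain ⟨ζ, hζj, hζx, hwζ, hxζ⟩ :
      ∃ ζ, (x = w → ζ ≠ j) ∧ ζ ≠ x ∧ H.Adj w₀ ζ ∧ ¬ H.Adj x ζ := by
    by_cases e : x = w
    · obtain ⟨ζ, h1, h2⟩ := exch_nonempty_ne (show deg H x + 2 ≤ deg H w₀ by
        have := hp.2.2 (e.trans (hxw.resolve_left (not_not.2 e)).symm); omega) j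
      exact ⟨ζ, fun _ => h1, h2⟩
    · obtain ⟨ζ, h2⟩ := exch_nonempty_of_lt (show deg H x < deg H w₀ by
        have := hp.1; omega)
      exact ⟨ζ, fun h => absurd h e, h2⟩
  obtain ⟨H', hH', hp', hadj⟩ := hH.exists_move hp.1 hζx hxζ hwζ hwA h0
  have := hwζ.ne
  have hc := H.adj_comm
  have key := hH'.adj_of_adj_of_deficient hB (hp' y hp) hy hw hne hz (j := j) ?_ ?_ hjA hwj
  all_goals simp only [hadj, Sym2.eq_iff, ne_eq] at *
  all_goals clear hadj hp' hB
  all_goals grind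

/-- A vertex adjacent to a non-neighbour of a vertex of largest demand is adjacent to all vertices
of largest demand. -/
lemma adj_of_adj (hH : IsMaxSubRealization A d H)
    (hB : ∀ v, v ∈ B ↔ v ∉ A ∧ d v = D) {x y w₀ w z j : V} (hx : x ∈ B) (hy : y ∈ B)
    (hp : Deficient d H x y) (hw₀ : w₀ ∈ B)
    (hw : w ∈ B) (hz : z ≠ w₀) (hwz : ¬ H.Adj w₀ z) (hzj : H.Adj z j)
    (hjA : j ∉ A) (hwj : w ≠ j) : H.Adj j w := by
  by_cases hne : w₀ = w
  swap
  · exact hH.adj_of_adj_of_ne hB hx hy hp hw₀ hw hne hz hwz hzj hjA hwj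
  subst hne
  obtain ⟨hwA, hwD⟩ := (hB w₀).1 hw₀
  -- the case of a deficient `w₀`
  have key : ∀ H : SimpleGraph V, IsMaxSubRealization A d H → ∀ y ∈ B, Deficient d H w₀ y →
      ¬ H.Adj w₀ z → H.Adj z j → ¬ H.Adj j w₀ → False := by
    intro H hH y hy hp hwz hzj hjw
    by_cases h2 : deg H w₀ + 2 ≤ d w₀
    · exact hH.augment_false ⟨hp.1, hp.1, fun _ => h2⟩ hz hwz hwj.symm (fun h => hjw h.symm) hzj
        (Or.inr hjA)
    have hyw : w₀ ≠ y := fun e => h2 (hp.2.2 e)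
    have hwy := hH.adj_of_deficient hp.1 hp.2.1 hyw
    have hyj : y ≠ j := fun e => hjw (e ▸ hwy.symm)
    have hjy := hH.adj_of_adj_of_ne hB hw₀ hy hp hw₀ hy hyw hz hwz hzj hjA hyj
    obtain ⟨ζ, hζy, hwζ, hyζ⟩ := exch_nonempty_of_le (show deg H y ≤ deg H w₀ by
      have := hp.2.1; have := ((hB y).1 hy).2; omega) hwj.symm hjy.symm (fun h => hjw h.symm)
    obtain ⟨H', hH', hp', hadj⟩ := hH.exists_move hp.2.1 hζy hyζ hwζ hwA hyw
    have := hwζ.ne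
    have hc := H.adj_comm
    refine hH'.augment_false (hp' w₀ hp.symm) hz ?_ hwj.symm ?_ ?_ (Or.inr hjA) (z := z)
    all_goals simp only [hadj, Sym2.eq_iff, ne_eq]
    all_goals grind
  by_contra hjw
  by_cases h0 : w₀ = x
  · subst h0
    exact key H hH y hy hp hwz hzj hjw
  by_cases hd0 : deg H w₀ < d w₀
  · exact key H hH x hx (deficient_of_ne hd0 hp.1 h0) hwz hzj hjw
  obtain ⟨ζ, hζx, hwζ, hxζ⟩ := exch_nonempty_of_lt (show deg H x < deg H w₀ by
    have := hp.1; have := ((hB x).1 hx).2; omega)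
  obtain ⟨H', hH', hp', hadj⟩ := hH.exists_move hp.1 hζx hxζ hwζ hwA h0
  have := hwζ.ne
  have hc := H.adj_comm
  refine key H' hH' y hy (hp' y hp) ?_ ?_ ?_
  all_goals simp only [hadj, Sym2.eq_iff, ne_eq]
  all_goals grind

lemma adj_mem_of_deficient (hH : IsMaxSubRealization A d H)
    (hB : ∀ v, v ∈ B ↔ v ∉ A ∧ d v = D) {x y o w : V} (hx : x ∈ B) (hy : y ∈ B)
    (hp : Deficient d H x y) (ho : deg H o < d o) (hw : w ∈ B) (hwo : w ≠ o) : H.Adj o w := by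
  by_cases h : x = o
  · subst h
    exact hH.adj_of_mem hB hx hy hp hx hw hwo.symm
  · exact hH.adj_of_deficient_of_le (deficient_of_ne hp.1 ho h) ((hB w).1 hw).1 hwo
      (by rw [((hB x).1 hx).2, ((hB w).1 hw).2])

end IsMaxSubRealization

end SubRealization

section CliqueBound

variable {V : Type} [Fintype V]

lemma exists_isSubRealization {G : SimpleGraph V} {A : Finset V}
    (hA : ∀ a ∈ A, A.card - 1 ≤ deg G a) : ∃ H, IsSubRealization A (deg G) H := by
  have hO : ∀ a, ∃ O : Finset V, a ∈ A → O ⊆ nbrs G a \ A ∧ O.card = deg G a - (A.card - 1) := by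
    intro a
    by_cases ha : a ∈ A
    swap
    · exact ⟨∅, fun h => absurd h ha⟩
    have h1 : (nbrs G a ∩ A).card ≤ A.card - 1 := by
      rw [← Finset.card_erase_of_mem ha]
      refine Finset.card_le_card fun v hv => ?_
      simp only [Finset.mem_inter, mem_nbrs] at hv
      exact Finset.mem_erase.2 ⟨hv.1.ne', hv.2⟩
    have h2 := Finset.card_sdiff_add_card_inter (nbrs G a) A
    rw [← deg_eq_card_nbrs] at h2
    obtain ⟨O, hO⟩ := Finset.exists_subset_card_eq
      (show deg G a - (A.card - 1) ≤ (nbrs G a \ A).card by omega)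
    exact ⟨O, fun _ => hO⟩
  choose O hO using hO
  let H : SimpleGraph V :=
    { Adj := fun p q => p ≠ q ∧ ((p ∈ A ∧ q ∈ A) ∨ (p ∈ A ∧ q ∉ A ∧ q ∈ O p) ∨
        (q ∈ A ∧ p ∉ A ∧ p ∈ O q) ∨ (p ∉ A ∧ q ∉ A ∧ G.Adj p q))
      symm := ⟨fun p q h => ⟨h.1.symm, by have := G.adj_comm p q; tauto⟩⟩
      loopless := ⟨fun p h => h.1 rfl⟩ }
  have hdegA : ∀ a ∈ A, deg H a = deg G a := by
    intro a ha
    obtain ⟨h1, h2⟩ := hO a ha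
    have h3 : ∀ v ∈ O a, v ∉ A := fun v hv => (Finset.mem_sdiff.1 (h1 hv)).2
    have : nbrs H a = A.erase a ∪ O a := by
      ext v
      simp only [mem_nbrs, Finset.mem_union, Finset.mem_erase, H]
      have := h3 v
      grind
    rw [deg_eq_card_nbrs, this, Finset.card_union_of_disjoint, h2, Finset.card_erase_of_mem ha]
    · have := hA a ha; omega
    · rw [Finset.disjoint_left]
      exact fun v hv hv' => h3 v hv' (Finset.mem_of_mem_erase hv)
  refine ⟨H, fun a ha b hb hab => ⟨hab, Or.inl ⟨ha, hb⟩⟩, hdegA, fun v => ?_⟩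
  by_cases hv : v ∈ A
  · exact (hdegA v hv).le
  · rw [deg_eq_card_nbrs, deg_eq_card_nbrs]
    refine Finset.card_le_card fun w hw => ?_
    have hw : H.Adj v w := mem_nbrs.1 hw
    obtain ⟨-, h | h | h | h⟩ := hw
    · exact absurd h.1 hv
    · exact absurd h.1 hv
    · exact mem_nbrs.2 (mem_nbrs.1 (Finset.mem_sdiff.1 ((hO w h.1).1 h.2.2)).1).symm
    · exact mem_nbrs.2 h.2.2

lemma exists_isMaxSubRealization {G : SimpleGraph V} {A : Finset V}
    (hA : ∀ a ∈ A, A.card - 1 ≤ deg G a) : ∃ H, IsMaxSubRealization A (deg G) H := by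
  obtain ⟨H, hH, hmax⟩ := (Set.toFinite {H | IsSubRealization A (deg G) H}).exists_maximalFor
    (fun H => ∑ v, deg H v) _ (exists_isSubRealization hA)
  exact ⟨H, hH, fun H' hH' => (le_total _ _).elim id fun h => hmax hH' h⟩

lemma sum_card_nbrs_inter_comm (H : SimpleGraph V) (S T : Finset V) :
    ∑ v ∈ S, (nbrs H v ∩ T).card = ∑ v ∈ T, (nbrs H v ∩ S).card := by
  have h : ∀ (S : Finset V) v, (nbrs H v ∩ S).card = ∑ w ∈ S, if H.Adj v w then 1 else 0 := by
    intro S v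
    rw [Finset.sum_boole, Finset.inter_comm, ← Finset.filter_mem_eq_inter]
    simp
  simp only [h]
  rw [Finset.sum_comm]
  simp only [H.adj_comm]

variable {A : Finset V} {d : V → ℕ} {H : SimpleGraph V}

/-- Exchanging `aj`, `w₀k` for `aw₀`, `jk` moves more edges at `A` to `B`. -/
lemma adj_of_maximal_inter {B : Finset V} (hB : ∀ v ∈ B, v ∉ A) (hH : IsMaxSubRealization A d H)
    {x y : V} (hp : Deficient d H x y)
    (hmax : ∀ H', IsMaxSubRealization A d H' → Deficient d H' x y →
      ∑ a ∈ A, (nbrs H' a ∩ B).card ≤ ∑ a ∈ A, (nbrs H a ∩ B).card)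
    {a j w₀ k : V} (ha : a ∈ A) (hj : j ∉ A) (hjB : j ∉ B) (haj : H.Adj a j) (hw₀ : w₀ ∈ B)
    (haw : ¬ H.Adj a w₀) (hk : k ∉ A) (hkw : H.Adj k w₀) (hkj : k ≠ j) : H.Adj j k := by
  by_contra hjk
  obtain ⟨H', hdeg, hadj⟩ := exists_edge_exchange haj hkw.symm haw hjk
    (fun h => hB w₀ hw₀ (h ▸ ha)) hkj.symm
  have hH' : IsMaxSubRealization A d H' := by
    refine ⟨⟨fun b hb c hc hbc => (hadj _ _).2 (Or.inl ⟨hH.1.1 b hb c hc hbc, ?_, ?_⟩),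
      fun b hb => (hdeg b).trans (hH.1.2.1 b hb), fun v => (hdeg v).le.trans (hH.1.2.2 v)⟩,
      fun H₂ hH₂ => ?_⟩
    · intro h
      rcases Sym2.eq_iff.1 h with ⟨-, rfl⟩ | ⟨rfl, -⟩ <;> tauto
    · intro h
      rcases Sym2.eq_iff.1 h with ⟨-, rfl⟩ | ⟨rfl, -⟩ <;> tauto
    · simpa only [hdeg] using hH.2 H₂ hH₂
  have hsub : ∀ b ∈ A, nbrs H b ∩ B ⊆ nbrs H' b ∩ B := by
    intro b hb v hv
    simp only [Finset.mem_inter, mem_nbrs] at hv ⊢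
    have hvA := hB v hv.2
    refine ⟨(hadj _ _).2 (Or.inl ⟨hv.1, fun h => ?_, fun h => ?_⟩), hv.2⟩
    · rcases Sym2.eq_iff.1 h with ⟨-, rfl⟩ | ⟨-, rfl⟩ <;> tauto
    · have := hB w₀ hw₀
      rcases Sym2.eq_iff.1 h with ⟨rfl, -⟩ | ⟨rfl, -⟩ <;> tauto
  refine (hmax H' hH' (by simpa only [Deficient, hdeg] using hp)).not_gt
    (Finset.sum_lt_sum (fun b hb => Finset.card_le_card (hsub b hb)) ⟨a, ha, ?_⟩)
  refine Finset.card_lt_card ((Finset.ssubset_iff_of_subset (hsub a ha)).2 ⟨w₀, ?_, ?_⟩)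
  · simp [hw₀, hadj]
  · simp [haw]

/-- Either the clique `A` can be completed to a realization, or the degrees satisfy an inequality
obtained by counting edges at a clique with `l` vertices outside `A`. -/
lemma exists_clique_or_bound {G : SimpleGraph V} {D : ℕ} {B : Finset V}
    (hs : ∀ a ∈ A, A.card - 1 ≤ deg G a) (hB : ∀ v, v ∈ B ↔ v ∉ A ∧ deg G v = D)
    (hD : ∀ v, v ∉ A → deg G v ≤ D) (hne : B.Nonempty)
    (hAB : ∀ a ∈ A, deg G a - (A.card - 1) < B.card) :
    (∃ H : SimpleGraph V, (∀ v, deg H v = deg G v) ∧ ∀ a ∈ A, ∀ b ∈ A, a ≠ b → H.Adj a b) ∨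
    ∃ l j b, B.card ≤ l ∧
      (Finset.univ.filter fun v => v ∉ A ∧ A.card - 2 ≤ deg G v).card ≤ b + l + j ∧
      l * (l - 1) + ∑ a ∈ A, (deg G a - (A.card - 1)) + l * j + b * (A.card - 2 - j) + 2 ≤
        l * D := by
  obtain ⟨H₀, hH₀⟩ := exists_isMaxSubRealization hs
  by_cases hfull : ∀ v, deg H₀ v = deg G v
  · exact Or.inl ⟨H₀, hfull, hH₀.1.1⟩
  right
  push Not at hfull
  obtain ⟨x, hx⟩ := hfull
  obtain ⟨y, hp⟩ := exists_deficient hH₀.1.2.2 (even_sum_deg G) (lt_of_le_of_ne (hH₀.1.2.2 x) hx)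
  obtain ⟨H₁, hH₁, x, hx, y, hy, hp⟩ := hH₀.exists_deficient_mem hB hD hne hp
  obtain ⟨H, ⟨hH, hp⟩, hmax⟩ :=
    (Set.toFinite {H | IsMaxSubRealization A (deg G) H ∧ Deficient (deg G) H x y}).exists_maximalFor
      (fun H => ∑ a ∈ A, (nbrs H a ∩ B).card) _ ⟨H₁, hH₁, hp⟩
  have hBA : ∀ v ∈ B, v ∉ A := fun v hv => ((hB v).1 hv).1
  have hexch := fun {a j w₀ k : V} => adj_of_maximal_inter hBA hH hp
    (fun H' h1 h2 => (le_total _ _).elim id fun h => hmax ⟨h1, h2⟩ h) (a := a) (j := j)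
    (w₀ := w₀) (k := k)
  have hcard : ∀ a ∈ A, (nbrs H a \ A).card = deg G a - (A.card - 1) := by
    intro a ha
    have h1 : nbrs H a ∩ A = A.erase a := by
      ext v
      simp only [Finset.mem_inter, mem_nbrs, Finset.mem_erase]
      exact ⟨fun h => ⟨h.1.ne', h.2⟩, fun h => ⟨hH.1.1 a ha v h.2 h.1.symm, h.2⟩⟩
    have h2 := Finset.card_sdiff_add_card_inter (nbrs H a) A
    rw [h1, Finset.card_erase_of_mem ha, ← deg_eq_card_nbrs, hH.1.2.1 a ha] at h2
    omega
  have hmiss : ∀ a ∈ A, ∃ w ∈ B, ¬ H.Adj a w := by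
    intro a ha
    by_contra! h
    refine (hAB a ha).not_ge ((hcard a ha).symm ▸ Finset.card_le_card fun w hw => ?_)
    exact Finset.mem_sdiff.2 ⟨mem_nbrs.2 (h w hw), hBA w hw⟩
  set F : Finset V := Finset.univ.filter fun v => v ∉ A ∧ (v ∈ B ∨ ∃ a ∈ A, H.Adj a v) with hF
  have memF : ∀ v, v ∈ F ↔ v ∉ A ∧ (v ∈ B ∨ ∃ a ∈ A, H.Adj a v) := by simp [hF]
  have hBF : B ⊆ F := fun v hv => (memF v).2 ⟨hBA v hv, Or.inl hv⟩
  set J : Finset V := Finset.univ.filter fun v => v ∉ A ∧ v ∉ F ∧ ∀ w ∈ B, H.Adj v w with hJ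
  have memJ : ∀ v, v ∈ J ↔ v ∉ A ∧ v ∉ F ∧ ∀ w ∈ B, H.Adj v w := by simp [hJ]
  set O : Finset V := (Finset.univ.filter fun v => v ∉ A ∧ A.card - 2 ≤ deg G v) \ (F ∪ J) with hO
  have hFB : ∀ f ∈ F, ∀ w ∈ B, f ≠ w → H.Adj f w := by
    intro f hf w hw hfw
    obtain ⟨hfA, hfB | ⟨a, ha, haf⟩⟩ := (memF f).1 hf
    · exact hH.adj_of_mem hB hx hy hp hfB hw hfw
    · obtain ⟨w₀, hw₀, haw⟩ := hmiss a ha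
      exact hH.adj_of_adj hB hx hy hp hw₀ hw (fun h => hBA w₀ hw₀ (h ▸ ha))
        (fun h => haw h.symm) haf hfA hfw.symm
  have hFF : ∀ f ∈ F, ∀ g ∈ F, f ≠ g → H.Adj f g := by
    intro f hf g hg hfg
    by_cases hgB : g ∈ B
    · exact hFB f hf g hgB hfg
    obtain ⟨hfA, hfB | ⟨a, ha, haf⟩⟩ := (memF f).1 hf
    · exact (hFB g hg f hfB hfg.symm).symm
    · by_cases hfB : f ∈ B
      · exact (hFB g hg f hfB hfg.symm).symm
      obtain ⟨w₀, hw₀, haw⟩ := hmiss a ha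
      exact hexch ha hfA hfB haf hw₀ haw ((memF g).1 hg).1
        (hFB g hg w₀ hw₀ fun h => hgB (h ▸ hw₀)) hfg.symm
  have hFJ : ∀ f ∈ F, ∀ g ∈ J, H.Adj f g := by
    intro f hf g hg
    obtain ⟨hgA, hgF, hgB⟩ := (memJ g).1 hg
    by_cases hfB : f ∈ B
    · exact (hgB f hfB).symm
    obtain ⟨hfA, h | ⟨a, ha, haf⟩⟩ := (memF f).1 hf
    · exact absurd h hfB
    · obtain ⟨w₀, hw₀, haw⟩ := hmiss a ha
      exact hexch ha hfA hfB haf hw₀ haw hgA (hgB w₀ hw₀) fun h => hgF (h ▸ hf)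
  have hOF : ∀ o ∈ O, A.card - 2 - J.card ≤ (nbrs H o ∩ F).card := by
    intro o ho
    simp only [hO, Finset.mem_sdiff, Finset.mem_filter, Finset.mem_univ, true_and,
      Finset.mem_union, not_or] at ho
    obtain ⟨⟨hoA, hod⟩, hoF, hoJ⟩ := ho
    obtain ⟨w, hw, how⟩ : ∃ w ∈ B, ¬ H.Adj o w := by
      by_contra! h
      exact hoJ ((memJ o).2 ⟨hoA, hoF, h⟩)
    have hwo : w ≠ o := fun h => hoF (hBF (h ▸ hw))
    have hdeg : deg H o = deg G o := le_antisymm (hH.1.2.2 o) (not_lt.1 fun h =>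
      how (hH.adj_mem_of_deficient hB hx hy hp h hw hwo))
    have hsub : nbrs H o ⊆ (nbrs H o ∩ F) ∪ J := by
      intro p hop
      have hop' := mem_nbrs.1 hop
      by_cases hpF : p ∈ F
      · exact Finset.mem_union_left _ (Finset.mem_inter.2 ⟨hop, hpF⟩)
      have hpA : p ∉ A := fun h => hoF ((memF o).2 ⟨hoA, Or.inr ⟨p, h, hop'.symm⟩⟩)
      exact Finset.mem_union_right _ ((memJ p).2 ⟨hpA, hpF, fun w' hw' =>
        hH.adj_of_adj hB hx hy hp hw hw' hwo.symm (fun h => how h.symm) hop' hpA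
          fun h => hpF (hBF (h ▸ hw'))⟩)
    have := (Finset.card_le_card hsub).trans (Finset.card_union_le _ _)
    rw [← deg_eq_card_nbrs] at this
    omega
  refine ⟨F.card, J.card, O.card, Finset.card_le_card hBF, ?_, ?_⟩
  · have h1 := Finset.card_le_card_sdiff_add_card (t := F ∪ J)
      (s := Finset.univ.filter fun v => v ∉ A ∧ A.card - 2 ≤ deg G v)
    have h2 := Finset.card_union_le F J
    rw [← hO] at h1
    omega
  have hlow : ∀ f ∈ F, (F.card - 1) + (nbrs H f ∩ A).card + J.card + (nbrs H f ∩ O).card ≤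
      deg H f := by
    intro f hf
    rw [deg_eq_card_nbrs, ← Finset.card_erase_of_mem hf, ← Finset.card_union_of_disjoint,
      ← Finset.card_union_of_disjoint, ← Finset.card_union_of_disjoint]
    · refine Finset.card_le_card fun v hv => ?_
      simp only [Finset.mem_union, Finset.mem_erase, Finset.mem_inter] at hv
      rcases hv with ((h | h) | h) | h
      · exact mem_nbrs.2 (hFF f hf v h.2 h.1.symm)
      · exact h.1
      · exact mem_nbrs.2 (hFJ f hf v h)
      · exact h.1
    all_goals
      rw [Finset.disjoint_left]
      intro v h1 h2
      have hFA : v ∈ F → v ∉ A := fun h => ((memF v).1 h).1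
      have hJA : v ∈ J → v ∉ A ∧ v ∉ F := fun h => ⟨((memJ v).1 h).1, ((memJ v).1 h).2.1⟩
      have hOA : v ∈ O → v ∉ A ∧ v ∉ F ∧ v ∉ J := by
        simp only [hO, Finset.mem_sdiff, Finset.mem_filter, Finset.mem_union]
        tauto
      simp only [Finset.mem_union, Finset.mem_erase, Finset.mem_inter] at h1 h2
      tauto
  have hsum := Finset.sum_le_sum hlow
  simp only [Finset.sum_add_distrib, Finset.sum_const, smul_eq_mul] at hsum
  rw [sum_card_nbrs_inter_comm H F A, sum_card_nbrs_inter_comm H F O] at hsum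
  have hsA : ∑ a ∈ A, (deg G a - (A.card - 1)) ≤ ∑ a ∈ A, (nbrs H a ∩ F).card := by
    refine Finset.sum_le_sum fun a ha => ?_
    rw [← hcard a ha]
    refine Finset.card_le_card fun v hv => ?_
    simp only [Finset.mem_sdiff, mem_nbrs] at hv
    exact Finset.mem_inter.2 ⟨mem_nbrs.2 hv.1, (memF v).2 ⟨hv.2, Or.inr ⟨a, ha, hv.1⟩⟩⟩
  have hsO : O.card * (A.card - 2 - J.card) ≤ ∑ o ∈ O, (nbrs H o ∩ F).card := by
    rw [← smul_eq_mul]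
    exact Finset.card_nsmul_le_sum _ _ _ hOF
  have hup : ∑ f ∈ F, (deg H f + (if f = x then 1 else 0) + (if f = y then 1 else 0)) ≤
      ∑ f ∈ F, D := by
    refine Finset.sum_le_sum fun f hf => (le_trans ?_ (hD f ((memF f).1 hf).1))
    have := hH.1.2.2 f
    obtain ⟨h1, h2, h3⟩ := hp
    split_ifs with e1 e2 e2
    · have := h3 (e1.symm.trans e2); subst e1; omega
    · subst e1; omega
    · subst e2; omega
    · omega
  simp only [Finset.sum_add_distrib, Finset.sum_ite_eq', hBF hx, hBF hy, if_true,
    Finset.sum_const, smul_eq_mul] at hup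
  omega

end CliqueBound

section CliqueRealization

lemma bound_false_of_card_le {s e l j b S : ℕ} (hel : e < l) (hbl : s ≤ b + l + j)
    (hS : s * e ≤ S) (hs : 1 ≤ s)
    (h : l * (l - 1) + S + l * j + b * (s - 2 - j) + 2 ≤ l * (s - 1 + e)) : False := by
  obtain ⟨l, rfl⟩ : ∃ k, l = k + 1 := ⟨l - 1, by omega⟩
  obtain ⟨s, rfl⟩ : ∃ k, s = k + 1 := ⟨s - 1, by omega⟩
  simp only [Nat.add_sub_cancel] at h
  obtain ⟨c, rfl⟩ : ∃ c, l = e + c := ⟨l - e, by omega⟩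
  rcases le_or_gt s (e + c) with hsl | hsl
  · obtain ⟨k, hk⟩ := Nat.exists_eq_add_of_le hsl
    nlinarith [Nat.zero_le ((e + c + 1) * j), Nat.zero_le (b * (s + 1 - 2 - j)),
      Nat.zero_le (k * (c + 1))]
  · obtain ⟨k, rfl⟩ := Nat.exists_eq_add_of_lt hsl
    rcases le_or_gt (k + 1) j with hj | hj
    · obtain ⟨r, rfl⟩ := Nat.exists_eq_add_of_le hj
      nlinarith [Nat.zero_le (b * (e + c + k + 1 + 1 - 2 - (k + 1 + r))),
        Nat.zero_le ((e + c + 1) * r), Nat.zero_le (e * (k + 1))]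
    · obtain ⟨m, rfl⟩ : ∃ m, k = j + m := ⟨k - j, by omega⟩
      rw [show e + c + (j + m) + 1 + 1 - 2 - j = e + c + m by omega] at h
      obtain ⟨r, rfl⟩ : ∃ r, b = m + 1 + r := ⟨b - (m + 1), by omega⟩
      nlinarith [Nat.zero_le (r * (e + c + m)), Nat.zero_le (m * m), Nat.zero_le (e * j),
        Nat.zero_le (e * m)]

lemma bound_false_of_le {s e l S : ℕ} (hel : e < l) (hl : s ≤ l + 1)
    (hS : s * e ≤ S) (hS' : (s - 1) * (s - 2) + e ≤ S) (hs : 2 ≤ s)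
    (h : l * (l - 1) + S + 2 ≤ l * (s - 1 + e)) : False := by
  obtain ⟨s, rfl⟩ : ∃ k, s = k + 2 := ⟨s - 2, by omega⟩
  obtain ⟨l, rfl⟩ : ∃ k, l = k + 1 := ⟨l - 1, by omega⟩
  simp only [Nat.add_sub_cancel, show s + 2 - 1 = s + 1 by omega] at h hS'
  obtain ⟨c, rfl⟩ : ∃ c, l = e + c := ⟨l - e, by omega⟩
  rcases Nat.eq_or_lt_of_le (show s ≤ e + c by omega) with hsl | hsl
  · subst hsl
    nlinarith [Nat.zero_le (e * c), Nat.zero_le (c * c)]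
  · obtain ⟨k, hk⟩ := Nat.exists_eq_add_of_lt hsl
    nlinarith [Nat.zero_le (k * (c + 1))]

variable {V : Type} [Fintype V]

/-- The graph `G` with all edges at `v` removed. -/
def isolate (G : SimpleGraph V) (v : V) : SimpleGraph V where
  Adj p q := G.Adj p q ∧ p ≠ v ∧ q ≠ v
  symm := ⟨fun _ _ h => ⟨h.1.symm, h.2.2, h.2.1⟩⟩
  loopless := ⟨fun _ h => G.loopless.irrefl _ h.1⟩

/-- The graph `K` together with all edges of `G` at `v`. -/
def glue (K G : SimpleGraph V) (v : V) : SimpleGraph V where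
  Adj p q := K.Adj p q ∨ (G.Adj p q ∧ (p = v ∨ q = v))
  symm := ⟨fun _ _ h => h.imp (fun h => h.symm) fun h => ⟨h.1.symm, h.2.symm⟩⟩
  loopless := ⟨fun _ h => h.elim (fun h => K.loopless.irrefl _ h) fun h => G.loopless.irrefl _ h.1⟩

lemma deg_isolate_self (G : SimpleGraph V) (v : V) : deg (isolate G v) v = 0 := by
  rw [deg_eq_card_nbrs, Finset.card_eq_zero, Finset.eq_empty_iff_forall_notMem]
  simp [isolate]

lemma not_adj_of_deg_eq_zero {K : SimpleGraph V} {v w : V} (h : deg K v = 0) : ¬ K.Adj v w := by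
  rw [deg_eq_card_nbrs, Finset.card_eq_zero, Finset.eq_empty_iff_forall_notMem] at h
  simpa using h w

lemma deg_glue_self {K : SimpleGraph V} {v : V} (h : deg K v = 0) (G : SimpleGraph V) :
    deg (glue K G v) v = deg G v :=
  deg_congr fun w => by simp [glue, not_adj_of_deg_eq_zero h]

lemma deg_glue_of_ne {K : SimpleGraph V} {v w : V} (h : deg K v = 0) (G : SimpleGraph V)
    (hw : w ≠ v) : deg (glue K G v) w = deg K w + if G.Adj w v then 1 else 0 := by
  have hK : ¬ K.Adj w v := fun h' => not_adj_of_deg_eq_zero h h'.symm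
  split_ifs with hG
  · have : nbrs (glue K G v) w = insert v (nbrs K w) := by
      ext x
      simp only [mem_nbrs, glue, Finset.mem_insert]
      grind
    rw [deg_eq_card_nbrs, this, Finset.card_insert_of_notMem (by simpa using hK),
      deg_eq_card_nbrs]
  · exact deg_congr fun x => by
      simp only [glue]
      grind

lemma deg_isolate_of_ne {v w : V} (G : SimpleGraph V) (hw : w ≠ v) :
    deg G w = deg (isolate G v) w + if G.Adj w v then 1 else 0 := by
  rw [← deg_glue_of_ne (deg_isolate_self G v) G hw]
  exact deg_congr fun x => by
    simp only [glue, isolate]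
    grind

/-- A graph whose vertices in `A` have the largest degrees can be rewired to make `A` a clique,
provided either enough vertices outside `A` have degree at least `#A - 2`, or all but one of the
vertices of `A` have degree at least `2 * #A - 3`. -/
lemma exists_clique {A : Finset V} {G : SimpleGraph V} (htop : ∀ a ∈ A, ∀ b ∉ A, deg G b ≤ deg G a)
    (hdeg : ∀ a ∈ A, A.card - 1 ≤ deg G a)
    (hcond : A.card ≤ (Finset.univ.filter fun b => b ∉ A ∧ A.card - 2 ≤ deg G b).card ∨
      ∃ a₀, ∀ a ∈ A, a ≠ a₀ → 2 * A.card - 3 ≤ deg G a) :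
    ∃ G', (∀ v, deg G' v = deg G v) ∧ ∀ a ∈ A, ∀ b ∈ A, a ≠ b → G'.Adj a b := by
  induction hs : A.card generalizing A G with
  | zero =>
    rw [Finset.card_eq_zero] at hs
    subst hs
    exact ⟨G, fun _ => rfl, by simp⟩
  | succ s ih =>
  have hA : A.Nonempty := Finset.card_pos.1 (by omega)
  obtain ⟨v, hvA, hv⟩ := A.exists_max_image (deg G) hA
  obtain ⟨m, hmA, hm⟩ := A.exists_min_image (deg G) hA
  set B : Finset V := Finset.univ.filter fun b => b ∉ A ∧ deg G b = deg G m with hBdef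
  have hB : ∀ x, x ∈ B ↔ x ∉ A ∧ deg G x = deg G m := by simp [hBdef]
  have hcard : (A.erase v).card = s := by rw [Finset.card_erase_of_mem hvA, hs]; rfl
  by_cases hbig : s + B.card ≤ deg G v
  · obtain ⟨G₁, hG₁, hadj⟩ := exists_adj_all (G := G) (S := A.erase v ∪ B) (v := v)
      (by simp [hB, hvA])
      (by
        rw [Finset.card_union_of_disjoint, hcard]
        · exact hbig
        · rw [Finset.disjoint_left]
          intro x hx hx'
          exact ((hB x).1 hx').1 (Finset.mem_of_mem_erase hx))
      (by
        intro x hx y hy hyv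
        simp only [Finset.mem_union, Finset.mem_erase, hB, not_or, not_and] at hx hy
        have hyA : y ∉ A := hy.1 hyv
        have := htop m hmA y hyA
        rcases hx with hx | hx
        · exact htop x hx.2 y hyA
        · omega)
    have hadj' : ∀ x ∈ A, x ≠ v → G₁.Adj x v := fun x hx hxv =>
      (hadj x (by simp [hx, hxv])).symm
    have hA₂ : ∀ x ∈ A, x ≠ v → deg G x = deg (isolate G₁ v) x + 1 := fun x hx hxv => by
      rw [← hG₁, deg_isolate_of_ne G₁ hxv, if_pos (hadj' x hx hxv)]
    have hle : ∀ x, x ≠ v → deg G x ≤ deg (isolate G₁ v) x + 1 ∧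
        deg (isolate G₁ v) x ≤ deg G x := fun x hxv => by
      rw [← hG₁, deg_isolate_of_ne G₁ hxv]
      split_ifs <;> omega
    have hv₂ := deg_isolate_self G₁ v
    obtain ⟨K, hK, hclique⟩ := ih (A := A.erase v) (G := isolate G₁ v)
      (by
        intro a ha b hb
        obtain ⟨hav, haA⟩ := Finset.mem_erase.1 ha
        by_cases hbv : b = v
        · subst hbv; omega
        have hbA : b ∉ A := fun h => hb (Finset.mem_erase.2 ⟨hbv, h⟩)
        have h1 := hA₂ a haA hav
        have h2 := hle b hbv
        have h3 := htop m hmA b hbA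
        have h4 := hm a haA
        by_cases hbB : b ∈ B
        · have h5 := deg_isolate_of_ne G₁ hbv
          rw [if_pos (hadj b (Finset.mem_union_right _ hbB)).symm, hG₁] at h5
          omega
        · have : deg G b ≠ deg G m := fun h => hbB ((hB b).2 ⟨hbA, h⟩)
          omega)
      (by
        intro a ha
        obtain ⟨hav, haA⟩ := Finset.mem_erase.1 ha
        have := hA₂ a haA hav
        have := hdeg a haA
        omega)
      (by
        rw [hcard]
        refine hcond.imp (fun h => ?_) ?_
        · have hsub : (Finset.univ.filter fun b => b ∉ A ∧ A.card - 2 ≤ deg G b) ⊆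
              Finset.univ.filter fun b => b ∉ A.erase v ∧ s - 2 ≤ deg (isolate G₁ v) b := by
            intro b hb
            simp only [Finset.mem_filter, Finset.mem_univ, true_and, Finset.mem_erase] at hb ⊢
            have hbv : b ≠ v := fun h => hb.1 (h ▸ hvA)
            have := hle b hbv
            exact ⟨fun h => hb.1 h.2, by omega⟩
          have := Finset.card_le_card hsub
          omega
        · rintro ⟨a₀, ha₀⟩
          refine ⟨a₀, fun a ha hne => ?_⟩
          obtain ⟨hav, haA⟩ := Finset.mem_erase.1 ha
          have := hA₂ a haA hav
          have := ha₀ a haA hne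
          omega)
      hcard
    have hKv : deg K v = 0 := by rw [hK, hv₂]
    refine ⟨glue K G₁ v, fun w => ?_, fun a ha b hb hab => ?_⟩
    · by_cases hw : w = v
      · subst hw
        rw [deg_glue_self hKv, hG₁]
      · rw [deg_glue_of_ne hKv _ hw, hK, ← deg_isolate_of_ne G₁ hw, hG₁]
    · by_cases hav : a = v
      · subst hav
        exact Or.inr ⟨(hadj' b hb hab.symm).symm, Or.inl rfl⟩
      · by_cases hbv : b = v
        · subst hbv
          exact Or.inr ⟨hadj' a ha hab, Or.inr rfl⟩
        · exact Or.inl (hclique a (Finset.mem_erase.2 ⟨hav, ha⟩) b (Finset.mem_erase.2 ⟨hbv, hb⟩)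
            hab)
  · have hvdeg := hdeg v hvA
    have hmdeg := hdeg m hmA
    have hBne : B.Nonempty := Finset.card_pos.1 (by omega)
    rcases exists_clique_or_bound hdeg hB (fun x hx => htop m hmA x hx) hBne
      (fun a ha => by have := hv a ha; have := hdeg a ha; omega) with h | ⟨l, j, b, hl, hblj, hsum⟩
    · exact h
    exfalso
    have hmv := hv m hmA
    obtain ⟨e, he⟩ : ∃ e, deg G m = A.card - 1 + e := ⟨deg G m - (A.card - 1), by omega⟩
    have hS : A.card * e ≤ ∑ a ∈ A, (deg G a - (A.card - 1)) := by
      rw [← smul_eq_mul]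
      refine Finset.card_nsmul_le_sum _ _ _ fun a ha => ?_
      have := hm a ha
      omega
    rw [he] at hsum
    have hel : e < l := by omega
    rcases hcond with hc | ⟨a₀, ha₀⟩
    · exact bound_false_of_card_le hel (hc.trans hblj) hS (by omega) hsum
    · rcases Nat.eq_zero_or_pos s with rfl | hspos
      · have hle : l * e ≤ l * (l - 1) := Nat.mul_le_mul_left _ (by omega)
        simp only [hs, zero_add, Nat.sub_self] at hsum
        omega
      obtain ⟨c, hcA, hc⟩ : ∃ c ∈ A, ∀ a ∈ A, a ≠ c → 2 * A.card - 3 ≤ deg G a := by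
        by_cases h : a₀ ∈ A
        · exact ⟨a₀, h, ha₀⟩
        · exact ⟨v, hvA, fun a ha _ => ha₀ a ha fun h' => h (h' ▸ ha)⟩
      obtain ⟨x, hx⟩ : (A.erase c).Nonempty :=
        Finset.card_pos.1 (by rw [Finset.card_erase_of_mem hcA]; omega)
      obtain ⟨hxc, hxA⟩ := Finset.mem_erase.1 hx
      have hxdeg := hc x hxA hxc
      have hxv := hv x hxA
      refine bound_false_of_le hel (by omega) hS ?_ (by omega)
        (le_trans (by omega) hsum)
      rw [← Finset.add_sum_erase _ _ hcA, add_comm]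
      refine add_le_add ?_ ?_
      · have := hm c hcA
        omega
      · rw [← Finset.card_erase_of_mem hcA, ← smul_eq_mul]
        refine Finset.card_nsmul_le_sum _ _ _ fun a ha => ?_
        obtain ⟨hac, haA⟩ := Finset.mem_erase.1 ha
        have := hc a haA hac
        rw [Finset.card_erase_of_mem hcA]
        omega

end CliqueRealization

section DegreeComplement

lemma deg_compl {V : Type} [Fintype V] (G : SimpleGraph V) (v : V) :
    deg Gᶜ v = Fintype.card V - 1 - deg G v := by
  rw [deg_eq_degree, deg_eq_degree, degree_compl]

lemma deg_comap_equiv {V W : Type} [Fintype V] [Fintype W] (G : SimpleGraph V) (e : W ≃ V)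
    (w : W) : deg (G.comap e) w = deg G (e w) := by
  rw [deg_eq_card_nbrs, deg_eq_card_nbrs, ← Finset.card_map e.toEmbedding]
  congr 1
  ext x
  simp [Finset.mem_map_equiv]

end DegreeComplement

/-- If π is not potentially T-graphic and π̄ is not potentially K_s-graphic, where T is a
tree of order t, s ≤ t-2 and n = t+s-2, then d_{t-s-1} ≥ t and d_t ≥ t-s+1. -/
theorem degrees_prop {t s : ℕ} {W : Type} [Fintype W] (T : SimpleGraph W)
    (hT : T.IsTree) (hcard : Fintype.card W = t) (hs : 2 ≤ s) (hst : s ≤ t - 2)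
    (π : Fin (t + s - 2) → ℕ) (hmono : Antitone π) (hg : Graphic π)
    (hnT : ¬ PotentiallyGraphic π T)
    (hnK : ¬ PotentiallyGraphic (compSeq π) (⊤ : SimpleGraph (Fin s))) :
    t ≤ π ⟨t - s - 2, by omega⟩ ∧ t - s + 1 ≤ π ⟨t - 1, by omega⟩ := by
  obtain ⟨G, hG⟩ := hg
  have hlow : π ⟨t - 2, by omega⟩ ≤ t - 2 := by
    by_contra! hlt
    have hA : (Finset.Iio (⟨t - 1, by omega⟩ : Fin (t + s - 2))).card = t - 1 := by simp
    have hge : ∀ a ∈ Finset.Iio (⟨t - 1, by omega⟩ : Fin (t + s - 2)), t - 1 ≤ π a := fun a ha => by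
      have hle : a ≤ ⟨t - 2, by omega⟩ := by
        simp only [Finset.mem_Iio, Fin.lt_def, Fin.le_def] at ha ⊢
        omega
      have := hmono hle
      omega
    obtain ⟨G', hG', hc⟩ := exists_containsCopy_tree (G := G)
      (A := Finset.Iio (⟨t - 1, by omega⟩ : Fin (t + s - 2))) hT
      (fun v hv p hp => by
        rw [hG, hG]
        refine hmono ?_
        simp only [Finset.mem_Iio, not_lt] at hv hp
        exact (hv.trans_le hp).le)
      (by omega) (by omega) (fun a ha => by rw [hA, hG]; exact hge a ha)
    exact hnT ⟨G', fun i => by rw [hG', hG], hc⟩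
  set A : Finset (Fin (t + s - 2)) := Finset.Ici ⟨t - 2, by omega⟩ with hAdef
  have hmem : ∀ i : Fin (t + s - 2), i ∈ A ↔ t - 2 ≤ (i : ℕ) := fun i => by
    simp [hAdef, Fin.le_def]
  have hA : A.card = s := by
    rw [hAdef, Fin.card_Ici]
    simp only
    omega
  have hdeg : ∀ i, deg Gᶜ i = t + s - 3 - π i := fun i => by
    rw [deg_compl, hG, Fintype.card_fin]
    omega
  have hcond : ¬ (A.card ≤ (Finset.univ.filter fun b => b ∉ A ∧ A.card - 2 ≤ deg Gᶜ b).card ∨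
      ∃ a₀, ∀ a ∈ A, a ≠ a₀ → 2 * A.card - 3 ≤ deg Gᶜ a) := fun hc => by
    obtain ⟨G', hG', hclique⟩ := exists_clique (A := A) (G := Gᶜ)
      (fun a ha b hb => by
        rw [hmem] at ha hb
        have : π a ≤ π b := hmono (Fin.le_def.2 (by omega))
        rw [hdeg, hdeg]
        omega)
      (fun a ha => by
        rw [hmem] at ha
        have : π a ≤ π ⟨t - 2, by omega⟩ := hmono (Fin.le_def.2 ha)
        rw [hdeg]
        omega)
      (by convert hc)
    refine hnK ⟨G'.comap Fin.revPerm, fun i => ?_, Fin.castLEEmb (by omega), fun x y hxy => ?_⟩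
    · rw [deg_comap_equiv, hG', hdeg, compSeq, Fin.revPerm_apply]
      omega
    · refine hclique _ ?_ _ ?_ ?_
      · rw [hmem]
        simp
        omega
      · rw [hmem]
        simp
        omega
      · simpa using hxy
  rw [not_or, hA] at hcond
  constructor
  · by_contra! hlt
    refine hcond.1 ?_
    have hsub : Finset.Ico (⟨t - s - 2, by omega⟩ : Fin (t + s - 2)) ⟨t - 2, by omega⟩ ⊆
        Finset.univ.filter fun b => b ∉ A ∧ s - 2 ≤ deg Gᶜ b := fun b hb => by
      simp only [Finset.mem_Ico, Finset.mem_filter, Finset.mem_univ, true_and, hmem, hdeg] at hb ⊢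
      have := hmono hb.1
      have := Fin.lt_def.1 hb.2
      simp only at this
      omega
    have := Finset.card_le_card hsub
    rw [Fin.card_Ico] at this
    simp only at this
    omega
  · by_contra! hlt
    refine hcond.2 ⟨⟨t - 2, by omega⟩, fun a ha hne => ?_⟩
    rw [hmem] at ha
    have hne' : (a : ℕ) ≠ t - 2 := fun h => hne (Fin.ext h)
    have : π a ≤ π ⟨t - 1, by omega⟩ := hmono (Fin.le_def.2 (by simp only; omega))
    rw [hdeg]
    omega
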